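/- Let d ∈ N, L ≥ 3, B ≥ 3 integers, c > 0, q ∈ [2,∞], and s ∈ N with s ≤ min{B/3, d}. Then there exists λ ≥ c^L · (B^{1−2/q})^{L−1}/12 such that for all M ∈ N, ν ∈ {±1}, and y ∈ [0,1]^d, the function ν · (λ/(Ms)) · θ^{(s)}_{M,y} is the realization of a ReLU network with architecture (d, B, …, B, 1) (B appearing L−1 times) whose weight matrices and bias vectors all have ℓ^q norm at most c. -/

import Mathlib

open scoped ENNReal

/-- The piecewise-linear "spike" function `Λ_{M,σ}`. -/
noncomputable def Lam (M σ t : ℝ) : ℝ :=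
  if t ≤ σ - 1 / M then 0 else 1 - M * |t - σ|

/-- The hat function `θ^{(s)}_{M,y}(x) = ρ((∑_{i=1}^s Λ_{M,y_i}(x_i)) - (s-1))`. -/
noncomputable def theta (d s : ℕ) (M : ℝ) (y x : Fin d → ℝ) : ℝ :=
  max 0 ((∑ i ∈ Finset.univ.filter (fun i : Fin d => (i : ℕ) < s), Lam M (y i) (x i))
    - ((s : ℝ) - 1))

/-- Hidden-layer outputs of a ReLU network. -/
noncomputable def layers (N : ℕ → ℕ)
    (W : (i : ℕ) → Matrix (Fin (N (i + 1))) (Fin (N i)) ℝ)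
    (b : (i : ℕ) → Fin (N (i + 1)) → ℝ) :
    (ℓ : ℕ) → (Fin (N 0) → ℝ) → (Fin (N ℓ) → ℝ)
  | 0 => fun x => x
  | (ℓ + 1) => fun x j => max 0 ((W ℓ).mulVec (layers N W b ℓ x) j + b ℓ j)

/-- Realization of a ReLU network with `L` layers (no ReLU on the last layer). -/
noncomputable def realize (N : ℕ → ℕ)
    (W : (i : ℕ) → Matrix (Fin (N (i + 1))) (Fin (N i)) ℝ)
    (b : (i : ℕ) → Fin (N (i + 1)) → ℝ) (L : ℕ) (x : Fin (N 0) → ℝ) :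
    Fin (N L) → ℝ :=
  match L with
  | 0 => x
  | (ℓ + 1) => fun j => (W ℓ).mulVec (layers N W b ℓ x) j + b ℓ j

/-- The architecture `(d, B, …, B, 1)` with `B` appearing in positions `1,…,L-1`. -/
def Narch (d B L : ℕ) (n : ℕ) : ℕ :=
  if n = 0 then d else if n < L then B else 1

/-- Entrywise ℓ^q norm of a matrix, for `q ∈ [1,∞]` (max of absolute entries for `q = ∞`). -/
noncomputable def matLqNorm {N M : ℕ} (q : ℝ≥0∞) (W : Matrix (Fin N) (Fin M) ℝ) : ℝ :=
  if q = ∞ then ⨆ i, ⨆ j, |W i j|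
  else (∑ i, ∑ j, |W i j| ^ q.toReal) ^ (1 / q.toReal)

/-- Entrywise ℓ^q norm of a vector, for `q ∈ [1,∞]`. -/
noncomputable def vecLqNorm {N : ℕ} (q : ℝ≥0∞) (v : Fin N → ℝ) : ℝ :=
  if q = ∞ then ⨆ i, |v i|
  else (∑ i, |v i| ^ q.toReal) ^ (1 / q.toReal)

theorem hat_beta_pow (B : ℕ) (hB : 1 ≤ B) (p : ℝ) (hp : 0 < p) :
    (B : ℝ) * ((B : ℝ) ^ (-(1 / p))) ^ p = 1 := by
  have hB0 : (0 : ℝ) < B := by exact_mod_cast hB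
  rw [← Real.rpow_mul hB0.le]
  have : -(1 / p) * p = -1 := by field_simp
  rw [this, Real.rpow_neg_one]
  field_simp

theorem hat_q_pos (q : ℝ≥0∞) (hq : 2 ≤ q) (h : q ≠ ∞) : 0 < q.toReal :=
  ENNReal.toReal_pos (by rintro rfl; simp at hq) h

theorem hat_root_le (c p S : ℝ) (hc : 0 < c) (hp : 0 < p) (hS0 : 0 ≤ S) (hS : S ≤ c ^ p) :
    S ^ (1 / p) ≤ c := by
  calc S ^ (1 / p) ≤ (c ^ p) ^ (1 / p) := Real.rpow_le_rpow hS0 hS (by positivity)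
    _ = c := by
      rw [← Real.rpow_mul hc.le]
      have : p * (1 / p) = 1 := by field_simp
      rw [this, Real.rpow_one]

theorem hat_vec_bound (q : ℝ≥0∞) (hq : 2 ≤ q) (c : ℝ) (hc : 0 < c) (B : ℕ) (hB : 1 ≤ B)
    {N : ℕ} (hN : N ≤ B) (v : Fin N → ℝ)
    (hv : ∀ i, |v i| ≤ c * (B : ℝ) ^ (-(1 / q.toReal))) : vecLqNorm q v ≤ c := by
  unfold vecLqNorm
  split_ifs with h
  · subst h
    refine Real.iSup_le (fun i => ?_) hc.le
    simpa using hv i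
  · have hp := hat_q_pos q hq h
    have hb := hat_beta_pow B hB _ hp
    set p := q.toReal
    set β := (B : ℝ) ^ (-(1 / p)) with hβ
    have hβ0 : 0 ≤ β := by positivity
    refine hat_root_le c p _ hc hp (Finset.sum_nonneg fun i _ => by positivity) ?_
    calc ∑ i, |v i| ^ p ≤ ∑ _i : Fin N, (c * β) ^ p :=
          Finset.sum_le_sum fun i _ => Real.rpow_le_rpow (abs_nonneg _) (hv i) hp.le
      _ = N * (c * β) ^ p := by simp
      _ ≤ B * (c * β) ^ p := by gcongr
      _ = c ^ p * (B * β ^ p) := by rw [Real.mul_rpow hc.le hβ0]; ring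
      _ = c ^ p := by rw [hb, mul_one]

theorem hat_mat_bound (q : ℝ≥0∞) (hq : 2 ≤ q) (c : ℝ) (hc : 0 < c) (B : ℕ) (hB : 1 ≤ B)
    {N K : ℕ} (hN : N ≤ B) (hK : K ≤ B) (W : Matrix (Fin N) (Fin K) ℝ)
    (hv : ∀ i j, |W i j| ≤ c * ((B : ℝ) ^ (-(1 / q.toReal))) ^ 2) : matLqNorm q W ≤ c := by
  unfold matLqNorm
  split_ifs with h
  · subst h
    refine Real.iSup_le (fun i => Real.iSup_le (fun j => ?_) hc.le) hc.le
    simpa using hv i j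
  · have hp := hat_q_pos q hq h
    have hb := hat_beta_pow B hB _ hp
    set p := q.toReal
    set β := (B : ℝ) ^ (-(1 / p)) with hβ
    have hβ0 : 0 ≤ β := by positivity
    refine hat_root_le c p _ hc hp
      (Finset.sum_nonneg fun i _ => Finset.sum_nonneg fun j _ => by positivity) ?_
    calc ∑ i, ∑ j, |W i j| ^ p ≤ ∑ _i : Fin N, ∑ _j : Fin K, (c * β ^ 2) ^ p :=
          Finset.sum_le_sum fun i _ => Finset.sum_le_sum fun j _ =>
            Real.rpow_le_rpow (abs_nonneg _) (hv i j) hp.le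
      _ = N * (K * (c * β ^ 2) ^ p) := by simp
      _ ≤ B * (B * (c * β ^ 2) ^ p) := by gcongr
      _ = c ^ p * ((B * β ^ p) * (B * β ^ p)) := by
          rw [Real.mul_rpow hc.le (by positivity), pow_two, Real.mul_rpow hβ0 hβ0]; ring
      _ = c ^ p := by rw [hb]; ring

/-- row-sparse matrices: each row has at most one nonzero entry -/
theorem hat_mat_bound_sparse (q : ℝ≥0∞) (hq : 2 ≤ q) (c : ℝ) (hc : 0 < c) (B : ℕ) (hB : 1 ≤ B)
    {N K : ℕ} (hN : N ≤ B) (W : Matrix (Fin N) (Fin K) ℝ) (f : Fin N → Fin K)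
    (h0 : ∀ i j, j ≠ f i → W i j = 0)
    (hv : ∀ i j, |W i j| ≤ c * (B : ℝ) ^ (-(1 / q.toReal))) : matLqNorm q W ≤ c := by
  by_cases h : q = ∞
  · unfold matLqNorm
    rw [if_pos h]
    subst h
    refine Real.iSup_le (fun i => Real.iSup_le (fun j => ?_) hc.le) hc.le
    simpa using hv i j
  · have hp := hat_q_pos q hq h
    have := hat_vec_bound q hq c hc B hB hN (fun i => W i (f i)) (fun i => hv i _)
    unfold vecLqNorm at this
    unfold matLqNorm
    rw [if_neg h] at this ⊢
    refine le_trans (le_of_eq ?_) this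
    congr 1
    refine Finset.sum_congr rfl fun i _ => ?_
    refine Finset.sum_eq_single (f i) (fun j _ hj => ?_) (by simp)
    rw [h0 i j hj]
    simp [Real.zero_rpow hp.ne']

theorem hat_mat_bound_row (q : ℝ≥0∞) (hq : 2 ≤ q) (c : ℝ) (hc : 0 < c) (B : ℕ) (hB : 1 ≤ B)
    {N K : ℕ} (hN : N ≤ 1) (hK : K ≤ B) (W : Matrix (Fin N) (Fin K) ℝ)
    (hv : ∀ i j, |W i j| ≤ c * (B : ℝ) ^ (-(1 / q.toReal))) : matLqNorm q W ≤ c := by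
  by_cases h : q = ∞
  · unfold matLqNorm
    rw [if_pos h]
    subst h
    refine Real.iSup_le (fun i => Real.iSup_le (fun j => ?_) hc.le) hc.le
    simpa using hv i j
  · have hp := hat_q_pos q hq h
    rcases Nat.le_one_iff_eq_zero_or_eq_one.mp hN with rfl | rfl
    · unfold matLqNorm
      rw [if_neg h]
      simp only [Finset.univ_eq_empty, Finset.sum_empty]
      rw [Real.zero_rpow (by positivity)]
      exact hc.le
    · have := hat_vec_bound q hq c hc B hB hK (fun j => W 0 j) (fun i => hv 0 _)
      unfold vecLqNorm at this
      unfold matLqNorm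
      rw [if_neg h] at this ⊢
      simpa using this

theorem hat_sum_three (g : ℕ → ℝ) (n : ℕ) :
    ∑ r ∈ Finset.range (3 * n), g r
      = ∑ m ∈ Finset.range n, (g (3 * m) + g (3 * m + 1) + g (3 * m + 2)) := by
  induction n with
  | zero => simp
  | succ n ih =>
    rw [Finset.sum_range_succ, ← ih, show 3 * (n + 1) = 3 * n + 1 + 1 + 1 by ring,
      Finset.sum_range_succ, Finset.sum_range_succ, Finset.sum_range_succ]
    ring

theorem hat_sum_mod (h : ℕ → ℝ) (s k : ℕ) :
    ∑ m ∈ Finset.range (s * k), h (m % s) = k * ∑ i ∈ Finset.range s, h i := by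
  induction k with
  | zero => simp
  | succ k ih =>
    rw [Nat.mul_succ, Finset.sum_range_add, ih]
    have : ∑ x ∈ Finset.range s, h ((s * k + x) % s) = ∑ i ∈ Finset.range s, h i := by
      refine Finset.sum_congr rfl fun i hi => ?_
      rw [Nat.mul_add_mod, Nat.mod_eq_of_lt (Finset.mem_range.mp hi)]
    rw [this]; push_cast; ring

theorem hat_Lam_eq (M σ t : ℝ) (hM : 0 < M) :
    max 0 (t - σ + 1 / M) - 2 * max 0 (t - σ) = Lam M σ t / M := by
  unfold Lam
  have hM' : 0 < 1 / M := by positivity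
  split_ifs with h
  · rw [max_eq_left (by linarith), max_eq_left (by linarith)]; simp
  · push Not at h
    rw [max_eq_right (by linarith)]
    rcases le_total t σ with h1 | h1
    · rw [max_eq_left (by linarith), abs_of_nonpos (by linarith)]; field_simp; ring
    · rw [max_eq_right (by linarith), abs_of_nonneg (by linarith)]; field_simp; ring

/-- weights, indexed by naturals -/
noncomputable def hatW (s k last : ℕ) (c β ν : ℝ) : ℕ → ℕ → ℕ → ℝ
  | 0 => fun r j => if r < 3 * (s * k) ∧ r % 3 ≠ 2 ∧ j = r / 3 % s then c * β else 0
  | 1 => fun _ j => if j < 3 * (s * k) then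
      (if j % 3 = 0 then c * β ^ 2 / 2 else if j % 3 = 1 then -(c * β ^ 2)
        else -(c * β ^ 2 / 2 * ((s - 1) / s))) else 0
  | i + 2 => fun _ _ => if i + 2 = last then ν * (c * β) else c * β ^ 2

/-- biases, indexed by naturals -/
noncomputable def hatb (s k : ℕ) (c β M : ℝ) (y : ℕ → ℝ) : ℕ → ℕ → ℝ
  | 0 => fun r => if r < 3 * (s * k) then
      (if r % 3 = 0 then c * β * (1 / M - y (r / 3 % s)) else if r % 3 = 1 then
        -(c * β * y (r / 3 % s)) else c * β * (1 / M)) else 0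
  | _ + 1 => fun _ => 0

/-- extension by zero of a vector -/
noncomputable def hatExt {d : ℕ} (x : Fin d → ℝ) (n : ℕ) : ℝ := if h : n < d then x ⟨n, h⟩ else 0

theorem hat_theta_eq {d s : ℕ} (hsd : s ≤ d) (M : ℝ) (y x : Fin d → ℝ) :
    theta d s M y x
      = max 0 ((∑ i ∈ Finset.range s, Lam M (hatExt y i) (hatExt x i)) - ((s : ℝ) - 1)) := by
  unfold theta
  congr 2
  rw [Finset.sum_filter]
  have h1 : ∀ i : Fin d, (if (i : ℕ) < s then Lam M (y i) (x i) else 0)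
      = (fun n : ℕ => if n < s then Lam M (hatExt y n) (hatExt x n) else 0) i := by
    intro i
    simp [hatExt]
  rw [Finset.sum_congr rfl fun i _ => h1 i,
    Fin.sum_univ_eq_sum_range (fun n : ℕ => if n < s then Lam M (hatExt y n) (hatExt x n) else 0),
    ← Finset.sum_filter]
  congr 1
  ext n
  simp only [Finset.mem_filter, Finset.mem_range]
  omega

theorem hat_relu_mul (a t : ℝ) (ha : 0 ≤ a) : max 0 (a * t) = a * max 0 t := by
  rw [mul_max_of_nonneg _ _ ha, mul_zero]

theorem hat_layer_one (d B L s k : ℕ) (last : ℕ) (hs1 : 1 ≤ s) (hsd : s ≤ d)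
    (c β ν M : ℝ) (hM : 0 < M) (hc : 0 ≤ c) (hβ : 0 ≤ β) (y x : Fin d → ℝ)
    (r : Fin (Narch d B L 1)) :
    layers (Narch d B L) (fun i r j => hatW s k last c β ν i r j)
      (fun i r => hatb s k c β M (hatExt y) i r) 1 x r
    = (fun r : ℕ => if r < 3 * (s * k) then
      (c * β * (if r % 3 = 0 then max 0 (hatExt x (r / 3 % s) - hatExt y (r / 3 % s) + 1 / M)
        else if r % 3 = 1 then max 0 (hatExt x (r / 3 % s) - hatExt y (r / 3 % s))
        else 1 / M)) else 0) r := by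
  have hcb : 0 ≤ c * β := by positivity
  have hidx : (r : ℕ) / 3 % s < d := lt_of_lt_of_le (Nat.mod_lt _ hs1) hsd
  have hsum : ∑ j : Fin d, hatW s k last c β ν 0 r j * x j
      = if (r : ℕ) < 3 * (s * k) ∧ (r : ℕ) % 3 ≠ 2 then c * β * hatExt x ((r : ℕ) / 3 % s)
        else 0 := by
    rw [Finset.sum_eq_single (⟨(r : ℕ) / 3 % s, hidx⟩ : Fin d)]
    · simp only [hatW, hatExt, hidx, and_true, dif_pos]
      split_ifs <;> simp
    · intro j _ hj
      have : ¬ ((j : ℕ) = (r : ℕ) / 3 % s) := fun h => hj (Fin.ext h)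
      simp [hatW, this]
    · simp
  have hl : layers (Narch d B L) (fun i r j => hatW s k last c β ν i r j)
      (fun i r => hatb s k c β M (hatExt y) i r) 1 x r
      = max 0 (∑ j : Fin d, hatW s k last c β ν 0 r j * x j
        + hatb s k c β M (hatExt y) 0 r) := rfl
  rw [hl, hsum]
  simp only [hatb]
  by_cases h : (r : ℕ) < 3 * (s * k)
  · have h3 : (r : ℕ) % 3 = 0 ∨ (r : ℕ) % 3 = 1 ∨ (r : ℕ) % 3 = 2 := by omega
    rcases h3 with h3 | h3 | h3
    · have e : c * β * hatExt x ((r : ℕ) / 3 % s) + c * β * (1 / M - hatExt y ((r : ℕ) / 3 % s))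
          = c * β * (hatExt x ((r : ℕ) / 3 % s) - hatExt y ((r : ℕ) / 3 % s) + 1 / M) := by ring
      simp [h, h3, -one_div, e, hat_relu_mul _ _ hcb]
    · have e : c * β * hatExt x ((r : ℕ) / 3 % s) + -(c * β * hatExt y ((r : ℕ) / 3 % s))
          = c * β * (hatExt x ((r : ℕ) / 3 % s) - hatExt y ((r : ℕ) / 3 % s)) := by ring
      simp only [h, h3]
      norm_num
      rw [← sub_eq_add_neg, ← mul_sub, hat_relu_mul _ _ hcb]
    · have : 0 ≤ c * β * (1 / M) := by positivity
      simp [h, h3, -one_div, this]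
  · simp [h]

theorem hat_Narch_mid (d B L i : ℕ) (h0 : 0 < i) (h : i < L) : Narch d B L i = B := by
  unfold Narch
  rw [if_neg (by omega), if_pos h]

theorem hat_Narch_le (d B L i : ℕ) (hB : 1 ≤ B) (h0 : 0 < i) : Narch d B L i ≤ B := by
  unfold Narch
  rw [if_neg (by omega)]
  split_ifs <;> omega

theorem hat_layer_two (d B L s k : ℕ) (hL : 3 ≤ L) (last : ℕ) (hs1 : 1 ≤ s) (hsd : s ≤ d)
    (hk : 3 * (s * k) ≤ B)
    (c β ν M : ℝ) (hM : 0 < M) (hc : 0 ≤ c) (hβ : 0 ≤ β) (y x : Fin d → ℝ)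
    (r : Fin (Narch d B L 2)) :
    layers (Narch d B L) (fun i r j => hatW s k last c β ν i r j)
      (fun i r => hatb s k c β M (hatExt y) i r) 2 x r
    = c * β ^ 2 / 2 * (c * β) * k / M * theta d s M y x := by
  set G : ℕ → ℝ := (fun r : ℕ => if r < 3 * (s * k) then
      (c * β * (if r % 3 = 0 then max 0 (hatExt x (r / 3 % s) - hatExt y (r / 3 % s) + 1 / M)
        else if r % 3 = 1 then max 0 (hatExt x (r / 3 % s) - hatExt y (r / 3 % s))
        else 1 / M)) else 0) with hG
  have hl : layers (Narch d B L) (fun i r j => hatW s k last c β ν i r j)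
      (fun i r => hatb s k c β M (hatExt y) i r) 2 x r
      = max 0 (∑ j : Fin (Narch d B L 1), hatW s k last c β ν 1 r j *
        layers (Narch d B L) (fun i r j => hatW s k last c β ν i r j)
          (fun i r => hatb s k c β M (hatExt y) i r) 1 x j + 0) := rfl
  have hs0 : (s : ℝ) ≠ 0 := by positivity
  have hsum : ∑ j : Fin (Narch d B L 1), hatW s k last c β ν 1 r j *
        layers (Narch d B L) (fun i r j => hatW s k last c β ν i r j)
          (fun i r => hatb s k c β M (hatExt y) i r) 1 x j
      = c * β ^ 2 / 2 * (c * β) * k / M *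
        ((∑ i ∈ Finset.range s, Lam M (hatExt y i) (hatExt x i)) - ((s : ℝ) - 1)) := by
    rw [Finset.sum_congr rfl fun j _ => by
      rw [hat_layer_one d B L s k last hs1 hsd c β ν M hM hc hβ y x j]]
    rw [← hG, Fin.sum_univ_eq_sum_range (fun j : ℕ => hatW s k last c β ν 1 r j * G j),
      hat_Narch_mid d B L 1 (by norm_num) (by omega)]
    have h1 : ∑ j ∈ Finset.range B, hatW s k last c β ν 1 r j * G j
        = ∑ j ∈ Finset.range (3 * (s * k)), hatW s k last c β ν 1 r j * G j := by
      symm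
      refine Finset.sum_subset (Finset.range_mono hk) fun j _ hj => ?_
      rw [Finset.mem_range] at hj
      simp [hatW, hj]
    rw [h1, hat_sum_three]
    have h2 : ∀ m ∈ Finset.range (s * k),
        hatW s k last c β ν 1 r (3 * m) * G (3 * m)
          + hatW s k last c β ν 1 r (3 * m + 1) * G (3 * m + 1)
          + hatW s k last c β ν 1 r (3 * m + 2) * G (3 * m + 2)
        = (fun i : ℕ => c * β ^ 2 / 2 * (c * β) / M *
            (Lam M (hatExt y i) (hatExt x i) - (s - 1) / s)) (m % s) := by
      intro m hm
      rw [Finset.mem_range] at hm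
      have a0 : 3 * m < 3 * (s * k) := by omega
      have a1 : 3 * m + 1 < 3 * (s * k) := by omega
      have a2 : 3 * m + 2 < 3 * (s * k) := by omega
      have b0 : 3 * m % 3 = 0 := by omega
      have b1 : (3 * m + 1) % 3 = 1 := by omega
      have b2 : (3 * m + 2) % 3 = 2 := by omega
      have c0 : 3 * m / 3 = m := by omega
      have c1 : (3 * m + 1) / 3 = m := by omega
      have c2 : (3 * m + 2) / 3 = m := by omega
      simp only [hG, hatW, a0, a1, a2, b0, b1, b2, c0, c1, c2, if_true]
      have hLam := hat_Lam_eq M (hatExt y (m % s)) (hatExt x (m % s)) hM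
      norm_num only [if_true, if_false]
      have e : Lam M (hatExt y (m % s)) (hatExt x (m % s)) =
        M * (max 0 (hatExt x (m % s) - hatExt y (m % s) + 1 / M)
          - 2 * max 0 (hatExt x (m % s) - hatExt y (m % s))) := by
        rw [hLam]; field_simp
      rw [e]
      field_simp
      ring
    rw [Finset.sum_congr rfl h2, hat_sum_mod (fun i : ℕ => c * β ^ 2 / 2 * (c * β) / M *
      (Lam M (hatExt y i) (hatExt x i) - (s - 1) / s)), ← Finset.mul_sum, Finset.sum_sub_distrib]
    simp only [Finset.sum_const, Finset.card_range, nsmul_eq_mul]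
    field_simp
  rw [hl, hsum, add_zero, hat_relu_mul _ _ (by positivity), ← hat_theta_eq hsd]

theorem hat_layer_deep (d B L s k : ℕ) (hL : 3 ≤ L) (hs1 : 1 ≤ s) (hsd : s ≤ d)
    (hk : 3 * (s * k) ≤ B)
    (c β ν M : ℝ) (hM : 0 < M) (hc : 0 ≤ c) (hβ : 0 ≤ β) (y x : Fin d → ℝ)
    (ℓ : ℕ) (hℓ : ℓ + 2 < L) (r : Fin (Narch d B L (ℓ + 2))) :
    layers (Narch d B L) (fun i r j => hatW s k (L - 1) c β ν i r j)
      (fun i r => hatb s k c β M (hatExt y) i r) (ℓ + 2) x r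
    = c * β ^ 2 / 2 * (c * β) * k / M * theta d s M y x * (B * (c * β ^ 2)) ^ ℓ := by
  induction ℓ with
  | zero => rw [pow_zero, mul_one]; exact hat_layer_two d B L s k hL _ hs1 hsd hk c β ν M hM hc hβ y x r
  | succ ℓ ih =>
    have hl : layers (Narch d B L) (fun i r j => hatW s k (L - 1) c β ν i r j)
        (fun i r => hatb s k c β M (hatExt y) i r) (ℓ + 1 + 2) x r
        = max 0 (∑ j : Fin (Narch d B L (ℓ + 2)), hatW s k (L - 1) c β ν (ℓ + 2) r j *
          layers (Narch d B L) (fun i r j => hatW s k (L - 1) c β ν i r j)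
            (fun i r => hatb s k c β M (hatExt y) i r) (ℓ + 2) x j + 0) := rfl
    rw [hl, Finset.sum_congr rfl fun j _ => by rw [ih (by omega) j]]
    have hne : ¬ (ℓ + 2 = L - 1) := by omega
    simp only [hatW, if_neg hne, Finset.sum_const, Finset.card_univ, Fintype.card_fin,
      nsmul_eq_mul, hat_Narch_mid d B L (ℓ + 2) (by omega) (by omega)]
    have hth : 0 ≤ theta d s M y x := le_max_left _ _
    rw [add_zero, max_eq_right (by positivity)]
    ring

/-- for `q ∈ [2,∞]`, there exists `λ ≥ c^L (B^{1-2/q})^{L-1}/12` such that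
for all `M ∈ ℕ`, `ν ∈ {±1}`, `y ∈ [0,1]^d`, the function `ν · (λ/(Ms)) · θ^{(s)}_{M,y}`
is the realization of a ReLU network with architecture `(d, B, …, B, 1)` whose weight
matrices and bias vectors all have ℓ^q norm at most `c` (for `q = ∞` the exponent
`1 - 2/q` is `1`, via `q.toReal = 0` and `2/0 = 0`). -/
theorem hat_function_network_big_q (d L B : ℕ) (hL : 3 ≤ L) (hB : 3 ≤ B)
    (c : ℝ) (hc : 0 < c) (q : ℝ≥0∞) (hq : 2 ≤ q)
    (s : ℕ) (hs1 : 1 ≤ s) (hsd : s ≤ d) (hsB : 3 * s ≤ B) :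
    ∃ lam : ℝ,
      c ^ L * ((B : ℝ) ^ (1 - 2 / q.toReal)) ^ (L - 1) / 12 ≤ lam ∧
      ∀ (M : ℕ), 0 < M → ∀ ν : ℝ, (ν = 1 ∨ ν = -1) →
        ∀ y ∈ Set.Icc (0 : Fin d → ℝ) 1,
        ∃ (W : (i : ℕ) → Matrix (Fin (Narch d B L (i + 1))) (Fin (Narch d B L i)) ℝ)
          (b : (i : ℕ) → Fin (Narch d B L (i + 1)) → ℝ),
          (∀ i < L, matLqNorm q (W i) ≤ c ∧ vecLqNorm q (b i) ≤ c) ∧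
          ∀ x : Fin d → ℝ,
            realize (Narch d B L) W b L x
              = fun _ => ν * (lam / ((M : ℝ) * s)) * theta d s (M : ℝ) y x := by
  obtain ⟨n, rfl⟩ : ∃ n, L = n + 3 := ⟨L - 3, by omega⟩
  set β : ℝ := (B : ℝ) ^ (-(1 / q.toReal)) with hβ
  have hB0 : (0 : ℝ) < B := by positivity
  have hβ0 : 0 < β := by positivity
  have hβ1 : β ≤ 1 := by
    apply Real.rpow_le_one_of_one_le_of_nonpos
    · exact_mod_cast (by omega : 1 ≤ B)
    · have : 0 ≤ 1 / q.toReal := by positivity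
      linarith
  obtain ⟨k, hk⟩ : ∃ k, k = B / (3 * s) := ⟨_, rfl⟩
  have hk1 : 1 ≤ k := by rw [hk]; exact (Nat.one_le_div_iff (by omega)).mpr hsB
  have hkB : 3 * (s * k) ≤ B := by rw [← mul_assoc, hk]; exact Nat.mul_div_le _ _
  have hBk : B ≤ 6 * (s * k) := by
    have h1 : B < 3 * s * (k + 1) := by rw [hk]; exact Nat.lt_mul_div_succ _ (by omega)
    nlinarith
  have hR : (B : ℝ) ^ (1 - 2 / q.toReal) = B * β ^ 2 := by
    rw [hβ, ← Real.rpow_natCast, ← Real.rpow_mul hB0.le, sub_eq_add_neg, Real.rpow_add hB0,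
      Real.rpow_one]
    congr 2
    push_cast
    ring
  refine ⟨s * (B * (c * β)) * (c * β ^ 2 / 2 * (c * β) * k) * (B * (c * β ^ 2)) ^ n, ?_, ?_⟩
  · rw [hR]
    have hBk' : (B : ℝ) ≤ 6 * (s * k) := by exact_mod_cast hBk
    have e1 : c ^ (n + 3) * (B * β ^ 2) ^ (n + 3 - 1) / 12
        = (c ^ 3 * B * β ^ 4 * (c ^ n * (B * β ^ 2) ^ n)) / 12 * B := by
      rw [show n + 3 - 1 = n + 2 by omega]; ring
    have e2 : s * (B * (c * β)) * (c * β ^ 2 / 2 * (c * β) * k) * (B * (c * β ^ 2)) ^ n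
        = (c ^ 3 * B * β ^ 4 * (c ^ n * (B * β ^ 2) ^ n)) / 12 * (6 * (s * k)) := by
      rw [show (B : ℝ) * (c * β ^ 2) = c * (B * β ^ 2) by ring, mul_pow]; ring
    rw [e1, e2]
    gcongr
  intro M hM ν hν y hy
  have hM0 : (0 : ℝ) < M := by exact_mod_cast hM
  have hM1 : 1 / (M : ℝ) ≤ 1 := by
    rw [div_le_one hM0]; exact_mod_cast hM
  have hMp : 0 < 1 / (M : ℝ) := by positivity
  have hs0 : (1 : ℝ) ≤ s := by exact_mod_cast hs1
  have hνabs : |ν| = 1 := by rcases hν with rfl | rfl <;> simp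
  have hy' : ∀ i, 0 ≤ hatExt y i ∧ hatExt y i ≤ 1 := by
    intro i
    unfold hatExt
    split_ifs with h
    · exact ⟨hy.1 _, hy.2 _⟩
    · norm_num
  have hcb : 0 < c * β := by positivity
  have hcb2 : 0 < c * β ^ 2 := by positivity
  have hB1 : 1 ≤ B := by omega
  refine ⟨fun i r j => hatW s k (n + 3 - 1) c β ν i r j,
    fun i r => hatb s k c β M (hatExt y) i r, ?_, ?_⟩
  · intro i hi
    constructor
    · match i with
      | 0 =>
        refine hat_mat_bound_sparse q hq c hc B hB1
          (hat_Narch_le d B _ 1 hB1 (by norm_num)) _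
          (fun r => (⟨(r : ℕ) / 3 % s, lt_of_lt_of_le (Nat.mod_lt _ hs1) hsd⟩ : Fin d)) ?_ ?_
        · intro r j hj
          have : ¬ ((j : ℕ) = (r : ℕ) / 3 % s) := fun h => hj (Fin.ext h)
          simp [hatW, this]
        · intro r j
          rw [← hβ]
          simp only [hatW]
          split_ifs
          · rw [abs_of_pos hcb]
          · simpa using hcb.le
      | 1 =>
        refine hat_mat_bound q hq c hc B hB1
          (hat_Narch_le d B _ _ hB1 (by norm_num)) (hat_Narch_le d B _ _ hB1 (by norm_num)) _ ?_
        intro r j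
        rw [← hβ]
        simp only [hatW]
        have hf0 : 0 ≤ ((s : ℝ) - 1) / s := div_nonneg (by linarith) (by linarith)
        have hf1 : ((s : ℝ) - 1) / s ≤ 1 := by rw [div_le_one (by linarith)]; linarith
        split_ifs
        · rw [abs_of_pos (by positivity)]; linarith
        · rw [abs_neg, abs_of_pos (by positivity)]
        · rw [abs_neg, abs_of_nonneg (by positivity)]; nlinarith
        · simpa using hcb2.le
      | i + 2 =>
        by_cases hlast : i + 2 = n + 3 - 1
        · refine hat_mat_bound_row q hq c hc B hB1 ?_
            (hat_Narch_le d B _ _ hB1 (by omega)) _ ?_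
          · unfold Narch
            rw [if_neg (by omega), if_neg (by omega)]
          · intro r j
            rw [← hβ]
            simp only [hatW, if_pos hlast]
            rw [abs_mul, hνabs, one_mul, abs_of_pos hcb]
        · refine hat_mat_bound q hq c hc B hB1
            (hat_Narch_le d B _ _ hB1 (by omega)) (hat_Narch_le d B _ _ hB1 (by omega)) _ ?_
          intro r j
          rw [← hβ]
          simp only [hatW, if_neg hlast]
          rw [abs_of_pos hcb2]
    · refine hat_vec_bound q hq c hc B hB1 (hat_Narch_le d B _ _ hB1 (by omega)) _ ?_
      intro r
      rw [← hβ]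
      match i with
      | 0 =>
        simp only [hatb]
        have := hy' ((r : ℕ) / 3 % s)
        split_ifs
        · rw [abs_mul, abs_of_pos hcb]
          have : |1 / (M : ℝ) - hatExt y ((r : ℕ) / 3 % s)| ≤ 1 := by
            rw [abs_le]; constructor <;> linarith
          nlinarith
        · rw [abs_neg, abs_mul, abs_of_pos hcb, abs_of_nonneg this.1]
          nlinarith
        · rw [abs_of_pos (by positivity)]
          nlinarith
        · simpa using hcb.le
      | i + 1 => simpa [hatb] using hcb.le
  · intro x
    funext r
    have hl : realize (Narch d B (n + 3)) (fun i r j => hatW s k (n + 3 - 1) c β ν i r j)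
        (fun i r => hatb s k c β M (hatExt y) i r) (n + 3) x r
        = ∑ j : Fin (Narch d B (n + 3) (n + 2)), hatW s k (n + 3 - 1) c β ν (n + 2) r j *
          layers (Narch d B (n + 3)) (fun i r j => hatW s k (n + 3 - 1) c β ν i r j)
            (fun i r => hatb s k c β M (hatExt y) i r) (n + 2) x j + 0 := rfl
    rw [hl, Finset.sum_congr rfl fun j _ => by
      rw [hat_layer_deep d B (n + 3) s k hL hs1 hsd hkB c β ν M hM0 hc.le hβ0.le y x n
        (by omega) j]]
    have he : n + 2 = n + 3 - 1 := by omega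
    simp only [hatW, if_pos he, Finset.sum_const, Finset.card_univ, Fintype.card_fin,
      nsmul_eq_mul, hat_Narch_mid d B (n + 3) (n + 2) (by omega) (by omega)]
    have : (s : ℝ) ≠ 0 := by positivity
    field_simp
    ring
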